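/- arXiv:2403.02098 — 4 statements merged into one kernel-verified Lean document; each statement's English description precedes it below -/
import Mathlib

section
/- Let F be a normed field whose norm is multiplicative, and let α : Fˣ → 𝕋 be a group homomorphism from the units of F to the circle group 𝕋 ⊂ ℂ. Let (ȧ, ä), (ḃ, b̈), (ċ, c̈) ∈ ℝ × Fˣ satisfy ȧ + ḃ + ċ = 1 and ä·b̈·c̈ = −1. Then for every x ∈ Fˣ with x ≠ ä one has the symmetry relation Ψ_{a,c}(−α, x⁻¹)·α(x) = Ψ̄_{a,b}(α, x); explicitly, α((1 − ä·x⁻¹)·c̈) · α(x) · ‖ä·x⁻¹‖^{ċ} · ‖1 − ä·x⁻¹‖^{ȧ−1} = α((1 − x·ä⁻¹)·b̈⁻¹) · ‖x·ä⁻¹‖^{ḃ} · ‖1 − x·ä⁻¹‖^{ȧ−1}, where real powers of the (positive) norms are taken in ℝ. -/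
/-- Symmetry relation for the angled quantum dilogarithm over a normed field `F`
(with multiplicative norm): for a unitary character `α : Fˣ →* Circle` and angles
`a = (adot, au)`, `b = (bdot, bu)`, `c = (cdot, cu)` with `adot + bdot + cdot = 1`
and `au * bu * cu = -1`, and every unit `x ≠ au`, one has
`Ψ_{a,c}(-α, x⁻¹) * α x = Ψ̄_{a,b}(α, x)`, explicitly:
`α((1 - au*x⁻¹)*cu) * α x * ‖au*x⁻¹‖^cdot * ‖1 - au*x⁻¹‖^(adot-1)
  = α((1 - x*au⁻¹)*bu⁻¹) * ‖x*au⁻¹‖^bdot * ‖1 - x*au⁻¹‖^(adot-1)`. -/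
theorem stmt_0 {F : Type*} [NormedField F] (α : Fˣ →* Circle)
    (adot bdot cdot : ℝ) (au bu cu : Fˣ)
    (hdot : adot + bdot + cdot = 1) (hu : au * bu * cu = -1)
    (x : Fˣ) (hx : x ≠ au) :
    (α (Units.mk0 (1 - (au : F) * ((x⁻¹ : Fˣ) : F))
        (by
          rw [sub_ne_zero]
          intro h
          have h2 : au * x⁻¹ = 1 :=
            Units.val_eq_one.mp (by rw [Units.val_mul]; exact h.symm)
          exact hx (mul_inv_eq_one.mp h2).symm) * cu) : ℂ)
      * (α x : ℂ)
      * ((‖(au : F) * ((x⁻¹ : Fˣ) : F)‖ ^ cdot : ℝ) : ℂ)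
      * ((‖1 - (au : F) * ((x⁻¹ : Fˣ) : F)‖ ^ (adot - 1) : ℝ) : ℂ) =
    (α (Units.mk0 (1 - (x : F) * ((au⁻¹ : Fˣ) : F))
        (by
          rw [sub_ne_zero]
          intro h
          have h2 : x * au⁻¹ = 1 :=
            Units.val_eq_one.mp (by rw [Units.val_mul]; exact h.symm)
          exact hx (mul_inv_eq_one.mp h2)) * bu⁻¹) : ℂ)
      * ((‖(x : F) * ((au⁻¹ : Fˣ) : F)‖ ^ bdot : ℝ) : ℂ)
      * ((‖1 - (x : F) * ((au⁻¹ : Fˣ) : F)‖ ^ (adot - 1) : ℝ) : ℂ) := by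
  have key : ∀ (h1 : 1 - (au : F) * ((x⁻¹ : Fˣ) : F) ≠ 0)
      (h2 : 1 - (x : F) * ((au⁻¹ : Fˣ) : F) ≠ 0),
      Units.mk0 _ h1 * cu * x = Units.mk0 _ h2 * bu⁻¹ := by
    intro h1 h2
    have hu' : (au : F) * bu * cu = -1 := by
      have := congrArg (Units.val) hu
      simpa using this
    ext
    simp only [Units.val_mul, Units.val_mk0, Units.val_inv_eq_inv_val]
    have hx0 := x.ne_zero
    have ha0 := au.ne_zero
    have hb0 := bu.ne_zero
    field_simp
    linear_combination ((x : F) - au) * hu'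
  have hn : ‖(au : F) * ((x⁻¹ : Fˣ) : F)‖ ^ cdot * ‖1 - (au : F) * ((x⁻¹ : Fˣ) : F)‖ ^ (adot - 1)
      = ‖(x : F) * ((au⁻¹ : Fˣ) : F)‖ ^ bdot
        * ‖1 - (x : F) * ((au⁻¹ : Fˣ) : F)‖ ^ (adot - 1) := by
    have hx0 := x.ne_zero
    have ha0 := au.ne_zero
    simp only [Units.val_inv_eq_inv_val]
    set t : F := (x : F) * (au : F)⁻¹ with ht
    have ht0 : t ≠ 0 := mul_ne_zero hx0 (inv_ne_zero ha0)
    have e1 : (au : F) * (x : F)⁻¹ = t⁻¹ := by rw [ht]; simp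
    have e2 : 1 - t⁻¹ = -(t⁻¹ * (1 - t)) := by field_simp; ring
    have hp : 0 < ‖t‖ := norm_pos_iff.mpr ht0
    rw [e1, e2, norm_neg, norm_mul, norm_inv,
      Real.mul_rpow (inv_nonneg.mpr hp.le) (norm_nonneg _), ← mul_assoc,
      ← Real.rpow_add (inv_pos.mpr hp), Real.inv_rpow hp.le, ← Real.rpow_neg hp.le]
    congr 2
    linarith
  rw [← Circle.coe_mul, ← map_mul, key, mul_assoc, mul_assoc, ← Complex.ofReal_mul,
    ← Complex.ofReal_mul, hn]
end

section
/- Let F be a field and let λ, μ ∈ F be nonzero. There exists a nonzero x ∈ F satisfying both equations 1 + x/(μ²λ) − x = 0 and 1/μ + μ²λ·x − x = 0 if and only if μ³λ = −1 and μ²λ ≠ 1. -/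
/-- For a field `F` and nonzero `lam, mu : F`, there exists a nonzero `x : F`
satisfying `1 + x/(mu^2*lam) - x = 0` and `1/mu + mu^2*lam*x - x = 0`
iff `mu^3*lam = -1` and `mu^2*lam ≠ 1`. -/
theorem stmt_1 {F : Type*} [Field F] (lam mu : F) (hlam : lam ≠ 0) (hmu : mu ≠ 0) :
    (∃ x : F, x ≠ 0 ∧ 1 + x / (mu ^ 2 * lam) - x = 0 ∧ 1 / mu + mu ^ 2 * lam * x - x = 0) ↔
      (mu ^ 3 * lam = -1 ∧ mu ^ 2 * lam ≠ 1) := by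
  have hcube : mu ^ 3 * lam = mu * (mu ^ 2 * lam) := by ring
  have ha : mu ^ 2 * lam ≠ 0 := mul_ne_zero (pow_ne_zero 2 hmu) hlam
  rw [hcube]
  generalize mu ^ 2 * lam = a at ha
  constructor
  · rintro ⟨x, _, h1, h2⟩
    have e1 : a + x - x * a = 0 := by
      have h : a * (1 + x / a - x) = a + x - x * a := by
        field_simp
      rw [← h, h1, mul_zero]
    have e2 : 1 + mu * a * x - mu * x = 0 := by
      have h : mu * (1 / mu + a * x - x) = 1 + mu * a * x - mu * x := by
        field_simp
      rw [← h, h2, mul_zero]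
    refine ⟨by linear_combination e2 + mu * e1, ?_⟩
    rintro rfl
    exact one_ne_zero (α := F) (by linear_combination e1)
  · rintro ⟨h, h1⟩
    have hs : a - 1 ≠ 0 := sub_ne_zero.mpr h1
    have hm : 1 / mu = -a := by
      rw [div_eq_iff hmu]
      linear_combination h
    refine ⟨a / (a - 1), div_ne_zero ha hs, ?_, ?_⟩
    · field_simp
      ring
    · rw [hm]
      field_simp
      ring
end

section
/- Let F be a field and let x, λ, μ ∈ F be nonzero. If x − λ − x² = 0 and x/μ − x²/(λμ²) − 1 = 0, then λ²μ² + (μ⁴ − μ³ − 2μ² − μ + 1)λ + μ² = 0. -/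
/-- Figure-eight knot: solutions of the localized delta-function system satisfy the
`PSL(2,ℂ)` A-polynomial equation in `lam` and `mu`. -/
theorem stmt_3 {F : Type*} [Field F] (x lam mu : F)
    (hx : x ≠ 0) (hlam : lam ≠ 0) (hmu : mu ≠ 0)
    (h1 : x - lam - x ^ 2 = 0)
    (h2 : x / mu - x ^ 2 / (lam * mu ^ 2) - 1 = 0) :
    lam ^ 2 * mu ^ 2 + (mu ^ 4 - mu ^ 3 - 2 * mu ^ 2 - mu + 1) * lam + mu ^ 2 = 0 := by
  have h3 : x * lam * mu - x ^ 2 - lam * mu ^ 2 = 0 := by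
    have h : x * lam * mu - x ^ 2 - lam * mu ^ 2
        = (lam * mu ^ 2) * (x / mu - x ^ 2 / (lam * mu ^ 2) - 1) := by
      field_simp
    rw [h, h2, mul_zero]
  -- divide by `x`, using `lam = x * (1 - x)`
  have h4 : x * (mu ^ 2 - 1) - mu * (mu - lam) = 0 := by
    apply mul_left_cancel₀ hx
    linear_combination h3 - mu ^ 2 * h1
  linear_combination (-(mu ^ 2 - 1) ^ 2) * h1
    - (mu * (mu - lam) + x * (mu ^ 2 - 1) - (mu ^ 2 - 1)) * h4
end

section
/- Let F be a field and let λ, μ ∈ F be nonzero with λμ ≠ 1 and μ² ≠ 1. If λ²μ² + (μ⁴ − μ³ − 2μ² − μ + 1)λ + μ² = 0, then x := λ(μ² − 1)/(λμ − 1) is a nonzero element of F satisfying both x − λ − x² = 0 and x/μ − x²/(λμ²) − 1 = 0. -/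
/-- Figure-eight knot, converse direction: a root of the A-polynomial equation yields a
nonzero solution `x = lam*(mu^2-1)/(lam*mu-1)` of the localized delta-function system. -/
theorem stmt_4 {F : Type*} [Field F] (lam mu : F)
    (hlam : lam ≠ 0) (hmu : mu ≠ 0) (h1 : lam * mu ≠ 1) (h2 : mu ^ 2 ≠ 1)
    (hA : lam ^ 2 * mu ^ 2 + (mu ^ 4 - mu ^ 3 - 2 * mu ^ 2 - mu + 1) * lam + mu ^ 2 = 0) :
    ∀ x : F, x = lam * (mu ^ 2 - 1) / (lam * mu - 1) →
      x ≠ 0 ∧ x - lam - x ^ 2 = 0 ∧ x / mu - x ^ 2 / (lam * mu ^ 2) - 1 = 0 := by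
  intro x hx
  have hd : lam * mu - 1 ≠ 0 := sub_ne_zero.mpr h1
  have hm : mu ^ 2 - 1 ≠ 0 := sub_ne_zero.mpr h2
  have hxd : x * (lam * mu - 1) = lam * (mu ^ 2 - 1) := by
    rw [hx, div_mul_cancel₀ _ hd]
  have hd2 : (lam * mu - 1) ^ 2 ≠ 0 := pow_ne_zero 2 hd
  have e1 : x - lam - x ^ 2 = 0 := by
    apply (mul_eq_zero.mp _).resolve_right hd2
    linear_combination (lam * mu - 1 - x * (lam * mu - 1) - lam * (mu ^ 2 - 1)) * hxd - lam * hA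
  have e2 : x * (lam * mu) - x ^ 2 - lam * mu ^ 2 = 0 := by
    apply (mul_eq_zero.mp _).resolve_right hd2
    linear_combination (lam * mu * (lam * mu - 1) - x * (lam * mu - 1) - lam * (mu ^ 2 - 1)) * hxd
      - lam * hA
  refine ⟨?_, e1, ?_⟩
  · rw [hx]
    exact div_ne_zero (mul_ne_zero hlam hm) hd
  · have e3 : x / mu - x ^ 2 / (lam * mu ^ 2) - 1
        = (x * (lam * mu) - x ^ 2 - lam * mu ^ 2) / (lam * mu ^ 2) := by
      field_simp
    rw [e3, e2, zero_div]
end
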